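/- arXiv:1808.02680 — 4 statements merged into one kernel-verified Lean document; each statement's English description precedes it below -/
import Mathlib

section
/- Let f be an R-bLSP morphism from B* to C*. Then: (i) for every letter β ∈ B, the last letter of f(β) is β; (ii) the set {f(β) : β ∈ B} is a suffix code, i.e., no f(β) is a proper suffix of another f(γ); (iii) f is injective both on finite words over B and on infinite words over B; (iv) for all letters β ∈ B and γ ∈ C, the letter γ occurs at most once in f(β). -/
section LSPDefs

variable {A : Type*} {B : Type*}

/-- `u` is a prefix of the infinite word `w`. -/
def IsPrefixI (u : List A) (w : ℕ → A) : Prop :=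
  ∀ (i : ℕ) (h : i < u.length), u.get ⟨i, h⟩ = w i

/-- `u` is a factor of the infinite word `w`. -/
def IsFactorI (u : List A) (w : ℕ → A) : Prop :=
  ∃ k : ℕ, ∀ (i : ℕ) (h : i < u.length), u.get ⟨i, h⟩ = w (k + i)

/-- `u` is a left special factor of the infinite word `w`. -/
def LeftSpecialI (u : List A) (w : ℕ → A) : Prop :=
  ∃ a b : A, a ≠ b ∧ IsFactorI (a :: u) w ∧ IsFactorI (b :: u) w

/-- An infinite word is LSP if all its left special factors are prefixes of it. -/
def IsLSP (w : ℕ → A) : Prop :=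
  ∀ u : List A, LeftSpecialI u w → IsPrefixI u w

/-- Application of a morphism (given by images of letters) to a finite word. -/
def applyM (f : A → List B) (u : List A) : List B := (u.map f).flatten

/-- The prefix of length `n` of an infinite word. -/
def infPrefix (w : ℕ → A) (n : ℕ) : List A := List.ofFn (fun i : Fin n => w i)

/-- `x` is the image of the infinite word `w` under the morphism `f`. -/
def InfImage (f : A → List B) (w : ℕ → A) (x : ℕ → B) : Prop :=
  ∀ n : ℕ, IsPrefixI (applyM f (infPrefix w n)) x

/-- `f` is a basic LSP (bLSP) endomorphism. -/
def IsBLSP (f : A → List A) : Prop :=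
  ∃ α : A, f α = [α] ∧ ∀ β : A, β ≠ α → ∃ γ : A, f β = f γ ++ [β]

/-- `f` is an R-bLSP morphism with domain alphabet `D`: the restriction to `D` of a
bLSP morphism `g` (letters outside the domain are sent to `[]`). -/
def IsRBLSPOn (D : Set A) (f : A → List A) : Prop :=
  (∀ x : A, x ∈ D ↔ f x ≠ []) ∧ ∃ g : A → List A, IsBLSP g ∧ ∀ x ∈ D, f x = g x

/-- The episturmian morphism `L_α`. -/
def Lmor [DecidableEq A] (α : A) : A → List A := fun β => if β = α then [α] else [α, β]

/-- `u` is an `(a,b,c,β,γ)`-fragility of `w`. -/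
def Frag5 (w : ℕ → A) (a b c β γ : A) (u : List A) : Prop :=
  IsPrefixI (u ++ [a]) w ∧ IsFactorI (β :: (u ++ [b])) w ∧ IsFactorI (γ :: (u ++ [c])) w

/-- `w` is `(a,b,c)`-fragile. -/
def Fragile (w : ℕ → A) (a b c : A) : Prop :=
  ∃ (u : List A) (β γ : A), β ≠ γ ∧ Frag5 w a b c β γ u

/-- `f` is LSP `(a,b,c)`-breaking (for words over the domain `D` of `f`). -/
def Breaking (D : Set A) (f : A → List A) (a b c : A) : Prop :=
  ∀ (w x : ℕ → A), Set.range w ⊆ D → IsLSP w → Fragile w a b c →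
    InfImage f w x → ¬ IsLSP x

/-- Length of the longest common prefix of two finite words. -/
noncomputable def lcpLen (u v : List A) : ℕ :=
  sSup {n | n ≤ u.length ∧ n ≤ v.length ∧ u.take n = v.take n}

/-- A morphism is nonerasing if images of letters are nonempty. -/
def Nonerasing (f : A → List B) : Prop := ∀ a : A, f a ≠ []

/-- `f` preserves the LSP property for infinite words. -/
def PreservesLSP (f : A → List B) : Prop :=
  ∀ (w : ℕ → A) (x : ℕ → B), IsLSP w → InfImage f w x → IsLSP x

/-- `f ∈ U(A,B)`: nonerasing and each letter of `B` occurs at most once in total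
among the images of letters. -/
def InU [Fintype A] [DecidableEq B] (f : A → List B) : Prop :=
  Nonerasing f ∧ ∀ b : B, (∑ a : A, (f a).count b) ≤ 1

/-- `u^k`. -/
def listPow (u : List B) (k : ℕ) : List B := (List.replicate k u).flatten

/-- `x = u^ω`. -/
def IsOmegaPow (u : List B) (x : ℕ → B) : Prop := ∀ k : ℕ, IsPrefixI (listPow u k) x

/-- `f ∈ P_LSP(A,B)`: nonerasing, all images are positive powers of a word `u`
with `u^ω` LSP. -/
def InPLSP (f : A → List B) : Prop :=
  Nonerasing f ∧ ∃ u : List B, u ≠ [] ∧ (∀ a : A, ∃ k : ℕ, 0 < k ∧ f a = listPow u k) ∧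
    ∀ x : ℕ → B, IsOmegaPow u x → IsLSP x

/-- `r` is the primitive root of `w`. -/
def IsPrimRoot (r w : List B) : Prop :=
  (∃ k : ℕ, 0 < k ∧ w = listPow r k) ∧
  ∀ (v : List B) (k : ℕ), 0 < k → w = listPow v k → r.length ≤ v.length

/-- Compatibility of a chain of morphisms `[g_1, …, g_n]` (composition
`g_1 ∘ ⋯ ∘ g_n`): every letter produced by `g_{i+1}` lies in the domain of `g_i`. -/
def CompatChain (L : List (B → List B)) : Prop :=
  List.Chain' (fun g h => ∀ x y, y ∈ h x → g y ≠ []) L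

end LSPDefs

theorem aux_last {A : Type*} {g : A → List A} {α : A} (h0 : g α = [α])
    (h1 : ∀ β : A, β ≠ α → ∃ γ : A, g β = g γ ++ [β]) (β : A) :
    ∃ l, g β = l ++ [β] := by
  by_cases h : β = α
  · subst h; exact ⟨[], by simpa using h0⟩
  · obtain ⟨γ, hγ⟩ := h1 β h
    exact ⟨_, hγ⟩

theorem aux_head {A : Type*} {g : A → List A} {α : A} (h0 : g α = [α])
    (h1 : ∀ β : A, β ≠ α → ∃ γ : A, g β = g γ ++ [β]) (n : ℕ) :
    ∀ β : A, (g β).length ≤ n → ∃ s, g β = α :: s := by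
  induction n with
  | zero =>
    intro β hb
    obtain ⟨l, hl⟩ := aux_last h0 h1 β
    simp [hl] at hb
  | succ n ih =>
    intro β hb
    by_cases h : β = α
    · subst h; exact ⟨[], h0⟩
    · obtain ⟨γ, hγ⟩ := h1 β h
      obtain ⟨s, hs⟩ := ih γ (by simp [hγ] at hb; omega)
      exact ⟨s ++ [β], by rw [hγ, hs]; rfl⟩

theorem aux_mem {A : Type*} {g : A → List A} {α : A} (h0 : g α = [α])
    (h1 : ∀ β : A, β ≠ α → ∃ γ : A, g β = g γ ++ [β]) (n : ℕ) :
    ∀ β : A, (g β).length ≤ n → (g β).Nodup ∧ ∀ δ ∈ g β, g δ <+: g β := by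
  induction n with
  | zero =>
    intro β hb
    obtain ⟨l, hl⟩ := aux_last h0 h1 β
    simp [hl] at hb
  | succ n ih =>
    intro β hb
    by_cases h : β = α
    · subst h
      rw [h0]
      simp [h0]
    · obtain ⟨γ, hγ⟩ := h1 β h
      obtain ⟨hn, hp⟩ := ih γ (by simp [hγ] at hb; omega)
      refine ⟨?_, ?_⟩
      · rw [hγ, List.nodup_append]
        refine ⟨hn, by simp, ?_⟩
        intro a ha b hb' hab
        simp at hb'
        subst hab
        subst hb'
        have := (hp _ ha).length_le
        simp [hγ] at this
      · intro δ hδ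
        rw [hγ] at hδ
        rcases List.mem_append.1 hδ with hd | hd
        · rw [hγ]; exact (hp _ hd).trans (List.prefix_append _ _)
        · simp at hd; subst hd; exact List.prefix_refl _

theorem aux_sync {A : Type*} {α : A} (t R : List A) (hR : R = [] ∨ ∃ R', R = α :: R')
    (s : List A) : ∀ s' : List A, α ∉ s → α ∉ s' → s ++ α :: t <+: s' ++ R → s = s' := by
  induction s with
  | nil =>
    intro s' _ h' hp
    cases s' with
    | nil => rfl
    | cons a s' =>
      simp [List.cons_prefix_cons] at hp h'
      exact absurd hp.1 h'.1
  | cons a s ih =>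
    intro s' h h' hp
    cases s' with
    | nil =>
      rcases hR with rfl | ⟨R', rfl⟩
      · simp at hp
      · simp [List.cons_prefix_cons] at hp h
        exact absurd hp.1.symm h.1
    | cons b s' =>
      simp [List.cons_prefix_cons] at hp h h'
      rw [hp.1, ih s' h.2 h'.2 hp.2]

theorem aux_prefix {A : Type*} {D : Set A} {f : A → List A} {α : A}
    (hl : ∀ x ∈ D, (f x).getLast? = some x)
    (hh : ∀ x ∈ D, ∃ s, α ∉ s ∧ f x = α :: s) (u : List A) :
    ∀ v : List A, (∀ x ∈ u, x ∈ D) → (∀ x ∈ v, x ∈ D) →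
      applyM f u <+: applyM f v → u.dropLast <+: v := by
  induction u with
  | nil => intros; simp
  | cons a u ih =>
    intro v hu hv hp
    cases u with
    | nil => simp
    | cons b u =>
      obtain ⟨s, hs, ha⟩ := hh a (hu a (by simp))
      obtain ⟨t, ht, hb⟩ := hh b (hu b (by simp))
      cases v with
      | nil => simp [applyM, ha] at hp
      | cons c v =>
        obtain ⟨s', hs', hc⟩ := hh c (hv c (by simp))
        have hR : applyM f v = [] ∨ ∃ R', applyM f v = α :: R' := by
          cases v with
          | nil => left; rfl
          | cons d v =>
            obtain ⟨t', _, hd⟩ := hh d (hv d (by simp))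
            right; exact ⟨t' ++ applyM f v, by simp [applyM, hd]⟩
        have e1 : applyM f (a :: b :: u) = α :: (s ++ α :: (t ++ applyM f u)) := by
          simp [applyM, ha, hb]
        have e2 : applyM f (c :: v) = α :: (s' ++ applyM f v) := by simp [applyM, hc]
        have hp' := hp
        rw [e1, e2, List.cons_prefix_cons] at hp'
        have hss := aux_sync _ _ hR s s' hs hs' hp'.2
        have hac : a = c := by
          have h1 := hl a (hu a (by simp))
          have h2 := hl c (hv c (by simp))
          rw [ha, hss, ← hc, h2] at h1
          exact (Option.some.inj h1).symm
        subst hac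
        have hq : applyM f (b :: u) <+: applyM f v := by
          have : f a ++ applyM f (b :: u) <+: f a ++ applyM f v := by
            simpa [applyM] using hp
          exact (List.prefix_append_right_inj _).1 this
        have := ih v (fun x hx => hu x (by simp at hx ⊢; tauto))
          (fun x hx => hv x (by simp [hx])) hq
        rw [List.dropLast_cons_of_ne_nil (by simp), List.cons_prefix_cons]
        exact ⟨rfl, this⟩

theorem aux_fin {A : Type*} {D : Set A} {f : A → List A}
    (hl : ∀ x ∈ D, (f x).getLast? = some x) (u : List A) :
    ∀ v : List A, (∀ x ∈ u, x ∈ D) → (∀ x ∈ v, x ∈ D) →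
      applyM f u = applyM f v → u = v := by
  have key : ∀ (l : List A) (a : A), a ∈ D → (applyM f (l ++ [a])).getLast? = some a := by
    intro l a ha
    simp [applyM, hl a ha]
  induction u using List.reverseRecOn with
  | nil =>
    intro v _ hv h
    rcases List.eq_nil_or_concat v with rfl | ⟨v, c, rfl⟩
    · rfl
    · have := key v c (hv c (by simp))
      simp only [List.concat_eq_append] at h
      rw [← h] at this
      simp [applyM] at this
  | append_singleton u a ih =>
    intro v hu hv h
    have k1 := key u a (hu a (by simp))
    rcases List.eq_nil_or_concat v with rfl | ⟨v, c, rfl⟩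
    · rw [h] at k1
      simp [applyM] at k1
    · simp only [List.concat_eq_append] at h hv ⊢
      have k2 := key v c (hv c (by simp))
      rw [h, k2] at k1
      have hac := Option.some.inj k1
      subst hac
      have : applyM f u = applyM f v := by simpa [applyM] using h
      rw [ih v (fun x hx => hu x (by simp [hx])) (fun x hx => hv x (by simp [hx])) this]

theorem aux_len {A : Type*} {D : Set A} {f : A → List A}
    (hne : ∀ x ∈ D, f x ≠ []) (u : List A) (hu : ∀ x ∈ u, x ∈ D) :
    u.length ≤ (applyM f u).length := by
  induction u with
  | nil => simp
  | cons a u ih =>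
    have h1 := ih (fun x hx => hu x (by simp [hx]))
    have h2 := List.length_pos_iff.2 (hne a (hu a (by simp)))
    have : applyM f (a :: u) = f a ++ applyM f u := by simp [applyM]
    rw [this, List.length_append, List.length_cons]
    omega

/-- basic properties of R-bLSP morphisms. -/
theorem rblsp_properties {A : Type*} [DecidableEq A] (D : Set A) (f : A → List A)
    (hf : IsRBLSPOn D f) :
    (∀ β ∈ D, (f β).getLast? = some β) ∧
    (∀ β ∈ D, ∀ γ ∈ D, f β <:+ f γ → β = γ) ∧
    (∀ u v : List A, (∀ x ∈ u, x ∈ D) → (∀ x ∈ v, x ∈ D) →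
      applyM f u = applyM f v → u = v) ∧
    (∀ (w w' : ℕ → A) (x : ℕ → A), Set.range w ⊆ D → Set.range w' ⊆ D →
      InfImage f w x → InfImage f w' x → w = w') ∧
    (∀ β ∈ D, ∀ γ : A, (f β).count γ ≤ 1) := by
  obtain ⟨hD, g, ⟨α, h0, h1⟩, hfg⟩ := hf
  have hl : ∀ x ∈ D, (f x).getLast? = some x := by
    intro x hx
    obtain ⟨l, hl⟩ := aux_last h0 h1 x
    rw [hfg x hx, hl]; simp
  have hnd : ∀ x ∈ D, (f x).Nodup := by
    intro x hx
    rw [hfg x hx]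
    exact (aux_mem h0 h1 _ x le_rfl).1
  have hh : ∀ x ∈ D, ∃ s, α ∉ s ∧ f x = α :: s := by
    intro x hx
    obtain ⟨s, hs⟩ := aux_head h0 h1 _ x le_rfl
    rw [← hfg x hx] at hs
    have := hnd x hx
    rw [hs, List.nodup_cons] at this
    exact ⟨s, this.1, hs⟩
  refine ⟨hl, ?_, ?_, ?_, ?_⟩
  · rintro β hβ γ hγ ⟨t, ht⟩
    have h2 := hl γ hγ
    rw [← ht, List.getLast?_append, hl β hβ] at h2
    simpa using h2
  · intro u v hu hv h
    exact aux_fin hl u v hu hv h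
  · intro w w' x hw hw' hx hx'
    have hmem : ∀ (w : ℕ → A), Set.range w ⊆ D → ∀ n, ∀ y ∈ infPrefix w n, y ∈ D := by
      intro w hw n y hy
      simp only [infPrefix, List.mem_ofFn] at hy
      obtain ⟨i, rfl⟩ := hy
      exact hw ⟨_, rfl⟩
    funext n
    have hlen := aux_len (f := f) (fun x hx => (hD x).1 hx)
      (infPrefix w' (applyM f (infPrefix w (n+2))).length) (hmem w' hw' _)
    have hpre : applyM f (infPrefix w (n+2)) <+:
        applyM f (infPrefix w' (applyM f (infPrefix w (n+2))).length) := by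
      have hlen' : (applyM f (infPrefix w (n+2))).length ≤
        (applyM f (infPrefix w' (applyM f (infPrefix w (n+2))).length)).length := by
        simpa [infPrefix] using hlen
      rw [List.prefix_iff_getElem]
      refine ⟨hlen', ?_⟩
      intro i hi
      have e1 := hx (n+2) i hi
      have e2 := hx' _ i (hi.trans_le hlen')
      simp only [List.get_eq_getElem] at e1 e2
      rw [e1, e2]
    have := aux_prefix hl hh _ _ (hmem w hw _) (hmem w' hw' _) hpre
    rw [List.prefix_iff_getElem] at this
    obtain ⟨_, h⟩ := this
    have := h n (by simp [infPrefix])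
    simpa only [infPrefix, List.getElem_dropLast, List.getElem_ofFn] using this
  · intro β hβ γ
    exact List.nodup_iff_count_le_one.1 (hnd β hβ) γ
end

section
/- For a finite alphabet A with #A = k ≥ 1, the number of bLSP endomorphisms of A* is exactly k^(k−1). -/
open Finset in
open Classical in
/-- Acyclic parent maps on `S` with root set `R`. -/
noncomputable def WF {A : Type*} [Fintype A] (S R : Finset A) : Finset (A → A) :=
  Finset.univ.filter (fun p => (∀ x, x ∉ S → p x = x) ∧ (∀ x ∈ S, p x ∈ S ∨ p x ∈ R) ∧
    ∃ rk : A → ℕ, ∀ x ∈ S, p x ∈ S → rk (p x) < rk x)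

theorem mem_WF {A : Type*} [Fintype A] {S R : Finset A} {p : A → A} :
    p ∈ WF S R ↔ (∀ x, x ∉ S → p x = x) ∧ (∀ x ∈ S, p x ∈ S ∨ p x ∈ R) ∧
    ∃ rk : A → ℕ, ∀ x ∈ S, p x ∈ S → rk (p x) < rk x := by
  simp [WF]

theorem WF_fiber {A : Type*} [Fintype A] [DecidableEq A] (S R T : Finset A)
    (hd : Disjoint S R) (hT : T ⊆ S) :
    ((WF S R).filter (fun p => S.filter (fun x => p x ∈ R) = T)).card
      = R.card ^ T.card * (WF (S \ T) T).card := by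
  have hq : (Fintype.piFinset (fun x : A => if x ∈ T then R else {x})).card
      = R.card ^ T.card := by
    rw [Fintype.card_piFinset]
    have : ∀ x : A, (if x ∈ T then R else {x}).card = if x ∈ T then R.card else 1 := by
      intro x; split_ifs <;> simp
    simp [this]
  rw [← hq, ← Finset.card_product]
  have hSR : ∀ x, x ∈ S → x ∉ R := fun x h1 h2 => (Finset.disjoint_left.mp hd) h1 h2
  refine Finset.card_bij'
    (fun p _ => ((fun x => if x ∈ T then p x else x), (fun x => if x ∈ S \ T then p x else x)))
    (fun q _ => fun x => if x ∈ T then q.1 x else q.2 x) ?_ ?_ ?_ ?_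
  · intro p hp
    rw [Finset.mem_filter, mem_WF] at hp
    obtain ⟨⟨h1, h2, rk, h3⟩, h4⟩ := hp
    have h5 : ∀ x, x ∈ T ↔ x ∈ S ∧ p x ∈ R := by intro x; rw [← h4]; simp
    rw [Finset.mem_product]
    constructor
    · rw [Fintype.mem_piFinset]
      intro x
      by_cases hx : x ∈ T
      · simpa [hx] using ((h5 x).1 hx).2
      · simp [hx]
    · rw [mem_WF]
      refine ⟨?_, ?_, rk, ?_⟩
      · intro x hx; simp only [hx, if_false]
      · intro x hx; simp only [hx, if_true]
        simp only [Finset.mem_sdiff] at *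
        have := h2 x hx.1
        have := h5 x
        tauto
      · intro x hx; simp only [hx, if_true]
        simp only [Finset.mem_sdiff] at *
        intro h; exact h3 x hx.1 h.1
  · rintro ⟨q, p⟩ h
    rw [Finset.mem_product, Fintype.mem_piFinset, mem_WF] at h
    obtain ⟨hq, h1, h2, rk, h3⟩ := h
    simp only at hq h1 h2 h3
    have hqT : ∀ x ∈ T, q x ∈ R := by intro x hx; simpa [hx] using hq x
    have h2' : ∀ x ∈ S, x ∉ T → p x ∈ S := by
      intro x hx hxT
      rcases h2 x (by simp [hx, hxT]) with h | h
      · exact (Finset.mem_sdiff.1 h).1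
      · exact hT h
    rw [Finset.mem_filter, mem_WF]
    refine ⟨⟨?_, ?_, fun x => if x ∈ T then 0 else rk x + 1, ?_⟩, ?_⟩
    · intro x hx
      have hxT : x ∉ T := fun h => hx (hT h)
      simp only [hxT, if_false]
      exact h1 x (by simp [hx])
    · intro x hx
      by_cases hxT : x ∈ T
      · simp only [hxT, if_true]; exact Or.inr (hqT x hxT)
      · simp only [hxT, if_false]; exact Or.inl (h2' x hx hxT)
    · intro x hx
      by_cases hxT : x ∈ T
      · simp only [hxT, if_true]; intro h; exact absurd (hqT x hxT) (hSR _ h)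
      · simp only [hxT, if_false]
        intro h
        by_cases hpT : p x ∈ T
        · simp [hpT]
        · simp only [hpT, if_false]
          have := h3 x (by simp [hx, hxT]) (by simp [h, hpT])
          omega
    · ext x
      simp only [Finset.mem_filter]
      by_cases hxT : x ∈ T
      · simp [hxT, hT hxT, hqT x hxT]
      · simp only [hxT, if_false, iff_false, not_and]
        intro hx; exact hSR _ (h2' x hx hxT)
  · intro p hp
    rw [Finset.mem_filter, mem_WF] at hp
    funext x
    by_cases hxT : x ∈ T
    · simp [hxT]
    · by_cases hx : x ∈ S
      · simp [hxT, hx]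
      · simp [hxT, hx, hp.1.1 x hx]
  · rintro ⟨q, p⟩ h
    rw [Finset.mem_product, Fintype.mem_piFinset, mem_WF] at h
    obtain ⟨hq, h1, -⟩ := h
    simp only at hq h1
    ext x
    · by_cases hxT : x ∈ T
      · simp [hxT]
      · have := hq x
        simp only [hxT, if_false, Finset.mem_singleton] at this
        simp [hxT, this]
    · by_cases hxT : x ∈ S \ T
      · simp only [hxT, if_true]; simp [(Finset.mem_sdiff.1 hxT).2]
      · simp only [hxT, if_false]; rw [h1 x hxT]

theorem WF_sum {A : Type*} [Fintype A] [DecidableEq A] (S R : Finset A)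
    (hd : Disjoint S R) :
    (WF S R).card = ∑ T ∈ S.powerset, R.card ^ T.card * (WF (S \ T) T).card := by
  rw [Finset.card_eq_sum_card_fiberwise (f := fun p => S.filter (fun x => p x ∈ R))
    (t := S.powerset)]
  · apply Finset.sum_congr rfl
    intro T hT
    exact WF_fiber S R T hd (Finset.mem_powerset.1 hT)
  · intro p _
    simp only [Finset.coe_powerset, Set.mem_preimage, Set.mem_powerset_iff, Finset.coe_subset]
    exact Finset.filter_subset _ _

theorem WF_empty {A : Type*} [Fintype A] [DecidableEq A] (S : Finset A) (hS : S.Nonempty) :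
    WF S ∅ = ∅ := by
  rw [Finset.eq_empty_iff_forall_notMem]
  intro p hp
  obtain ⟨-, h2, rk, h3⟩ := mem_WF.1 hp
  obtain ⟨x, hx, hmin⟩ := Finset.exists_min_image S rk hS
  have h := h2 x hx
  simp only [Finset.notMem_empty, or_false] at h
  have := h3 x hx h
  have := hmin _ h
  omega

theorem WF_card {A : Type*} [Fintype A] [DecidableEq A] (n : ℕ) : ∀ (S R : Finset A),
    Disjoint S R → S.card = n →
    (WF S R).card * (n + R.card) = R.card * (n + R.card) ^ n := by
  induction n using Nat.strong_induction_on with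
  | _ n ih =>
  intro S R hd hS
  rcases n with _ | m
  · have : S = ∅ := Finset.card_eq_zero.1 hS
    subst this
    have : (WF (∅ : Finset A) R) = {fun x => x} := by
      ext p
      rw [mem_WF, Finset.mem_singleton]
      constructor
      · intro h; funext x; exact h.1 x (by simp)
      · rintro rfl; simp
    simp [this]
  · have key : (WF S R).card * (m + 1) = (R.card * (m + 1 + R.card) ^ m) * (m + 1) := by
      rw [WF_sum S R hd, Finset.sum_mul]
      have h1 : ∀ T ∈ S.powerset, R.card ^ T.card * (WF (S \ T) T).card * (m + 1)
          = (fun s => R.card ^ s * (s * (m + 1) ^ (m + 1 - s))) T.card := by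
        intro T hT
        have hT := Finset.mem_powerset.1 hT
        rcases T.eq_empty_or_nonempty with rfl | hne
        · rw [Finset.sdiff_empty, WF_empty S (Finset.card_pos.1 (by omega))]
          simp
        · have hc := Finset.card_sdiff_of_subset hT
          have hpos := Finset.card_pos.2 hne
          have hle := Finset.card_le_card hT
          have := ih (m + 1 - T.card) (by omega) (S \ T) T Finset.sdiff_disjoint (by omega)
          rw [show m + 1 - T.card + T.card = m + 1 by omega] at this
          simp only
          rw [mul_assoc, this]
      rw [Finset.sum_congr rfl h1, Finset.sum_powerset_apply_card
        (fun s => R.card ^ s * (s * (m + 1) ^ (m + 1 - s))), hS,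
        Finset.sum_range_succ', add_comm (m + 1) R.card, add_pow R.card (m + 1) m, Finset.mul_sum, Finset.sum_mul]
      simp only [zero_mul, mul_zero, add_zero, smul_eq_mul]
      apply Finset.sum_congr rfl
      intro s _
      have := Nat.add_one_mul_choose_eq m s
      rw [Nat.add_sub_add_right]
      calc _ = (m + 1).choose (s + 1) * (s + 1) * (R.card ^ (s + 1) * (m + 1) ^ (m - s)) := by ring
        _ = _ := by rw [← this, Nat.cast_id]; ring
    have := Nat.eq_of_mul_eq_mul_right (Nat.succ_pos m) key
    rw [this]; ring

/-- `p` is the parent map of `f` with root `α`. -/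
def PRel {A : Type*} (f : A → List A) (p : A → A) (α : A) : Prop :=
  f α = [α] ∧ p α = α ∧ ∀ β, β ≠ α → f β = f (p β) ++ [β]

theorem exists_PRel {A : Type*} (f : A → List A) (hf : IsBLSP f) : ∃ p α, PRel f p α := by
  classical
  obtain ⟨α, h1, h2⟩ := hf
  choose g hg using h2
  refine ⟨fun x => if h : x = α then α else g x h, α, h1, by simp, ?_⟩
  intro β hβ
  simp only [hβ, dif_neg, not_false_eq_true]
  exact hg β hβ

theorem PRel.last {A : Type*} {f : A → List A} {p : A → A} {α : A} (h : PRel f p α) (x : A) :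
    (f x).getLast? = some x := by
  by_cases hx : x = α
  · subst hx; rw [h.1]; rfl
  · rw [h.2.2 x hx]; simp

theorem PRel.inj {A : Type*} {f : A → List A} {p : A → A} {α : A} (h : PRel f p α) {x y : A}
    (e : f x = f y) : x = y := by
  have := h.last x
  rw [e, h.last y] at this
  exact (Option.some.inj this).symm

theorem PRel.len {A : Type*} {f : A → List A} {p : A → A} {α : A} (h : PRel f p α) (x : A)
    (hx : x ≠ α) : (f (p x)).length < (f x).length := by
  rw [h.2.2 x hx]; simp

theorem PRel.ne {A : Type*} {f : A → List A} {p : A → A} {α : A} (h : PRel f p α) (x : A)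
    (hx : x ≠ α) : p x ≠ x := by
  intro e
  have := h.len x hx
  rw [e] at this
  omega

theorem PRel.root {A : Type*} {f f' : A → List A} {p : A → A} {α α' : A} (h : PRel f p α)
    (h' : PRel f' p α') : α = α' := by
  by_contra hne
  exact h'.ne α hne h.2.1

theorem PRel.f_unique {A : Type*} {f f' : A → List A} {p : A → A} {α α' : A} (h : PRel f p α)
    (h' : PRel f' p α') : f = f' := by
  obtain rfl := h.root h'
  have : ∀ n x, (f x).length = n → f x = f' x := by
    intro n
    induction n using Nat.strong_induction_on with
    | _ n ih =>
    intro x hx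
    by_cases hxa : x = α
    · subst hxa; rw [h.1, h'.1]
    · rw [h.2.2 x hxa, h'.2.2 x hxa, ih _ (hx ▸ h.len x hxa) (p x) rfl]
  funext x
  exact this _ x rfl

theorem PRel.p_unique {A : Type*} {f : A → List A} {p p' : A → A} {α α' : A} (h : PRel f p α)
    (h' : PRel f p' α') : p = p' := by
  have e : α = α' := by
    by_contra hne
    have h1 := h'.2.2 α hne
    have h2 := h'.last (p' α)
    rw [h.1] at h1
    have h3 := congrArg List.length h1
    simp only [List.length_append, List.length_singleton] at h3
    have h4 : f (p' α) = [] := List.length_eq_zero_iff.1 (by omega)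
    rw [h4] at h2
    simp at h2
  subst e
  funext x
  by_cases hx : x = α
  · subst hx; rw [h.2.1, h'.2.1]
  · have := (h.2.2 x hx).symm.trans (h'.2.2 x hx)
    exact h.inj (List.append_cancel_right this)

theorem PRel.mem {A : Type*} [Fintype A] [DecidableEq A] {f : A → List A} {p : A → A} {α : A}
    (h : PRel f p α) : p ∈ WF (Finset.univ.erase α) {α} := by
  rw [mem_WF]
  refine ⟨?_, ?_, fun x => (f x).length, ?_⟩
  · intro x hx
    have : x = α := by simpa using hx
    rw [this, h.2.1]
  · intro x _
    simp only [Finset.mem_erase, Finset.mem_univ, and_true, Finset.mem_singleton]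
    tauto
  · intro x hx _
    exact h.len x (Finset.mem_erase.1 hx).1

open Classical in
/-- Path word with fuel. -/
noncomputable def pathW {A : Type*} (p : A → A) (α : A) : ℕ → A → List A
  | 0, _ => []
  | n + 1, x => if x = α then [α] else pathW p α n (p x) ++ [x]

theorem exists_of_mem {A : Type*} [Fintype A] [DecidableEq A] {p : A → A} {α : A}
    (h : p ∈ WF (Finset.univ.erase α) {α}) : ∃ f, PRel f p α := by
  obtain ⟨h1, -, rk, h3⟩ := mem_WF.1 h
  let rk' : A → ℕ := fun x => if x = α then 0 else rk x + 1
  have hr : ∀ x, x ≠ α → rk' (p x) < rk' x := by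
    intro x hx
    by_cases hp : p x = α
    · simp [rk', hp, hx]
    · have := h3 x (by simp [hx]) (by simp [hp])
      simp only [rk', hp, hx, if_false]; omega
  have hst : ∀ n x, rk' x < n → pathW p α (n + 1) x = pathW p α n x := by
    intro n
    induction n with
    | zero => intro x hx; omega
    | succ n ih =>
      intro x hx
      by_cases hxa : x = α
      · simp [pathW, hxa]
      · have := ih (p x) (by have := hr x hxa; omega)
        rw [pathW, this]
        conv_rhs => rw [pathW]
  obtain ⟨N, hN⟩ : ∃ N, ∀ x, rk' x < N :=
    ⟨Finset.univ.sup rk' + 1, fun x => Nat.lt_succ_of_le (Finset.le_sup (Finset.mem_univ x))⟩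
  refine ⟨pathW p α (N + 1), by simp [pathW], h1 α (by simp), ?_⟩
  intro β hβ
  rw [hst N (p β) (hN _), pathW, if_neg hβ]

/-- there are exactly `k^(k-1)` bLSP endomorphisms of a `k`-letter
alphabet. -/
theorem card_bLSP {A : Type*} [Fintype A] [DecidableEq A] (k : ℕ) (hk : 1 ≤ k)
    (hcard : Fintype.card A = k) :
    Nat.card {f : A → List A // IsBLSP f} = k ^ (k - 1) := by
  have hb : Nat.card {f : A → List A // IsBLSP f}
      = ((Finset.univ : Finset A).biUnion (fun α => WF (Finset.univ.erase α) {α})).card := by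
    choose P r hP using (fun f : {f : A → List A // IsBLSP f} => exists_PRel f.1 f.2)
    rw [← Nat.card_eq_finsetCard]
    refine Nat.card_congr (Equiv.ofBijective
      (fun f => ⟨P f, Finset.mem_biUnion.2 ⟨r f, Finset.mem_univ _, (hP f).mem⟩⟩) ⟨?_, ?_⟩)
    · intro f g e
      have e' : P f = P g := congrArg Subtype.val e
      have h2 := hP g
      rw [← e'] at h2
      exact Subtype.ext ((hP f).f_unique h2)
    · rintro ⟨p, hp⟩
      obtain ⟨α, -, hα⟩ := Finset.mem_biUnion.1 hp
      obtain ⟨f, hf⟩ := exists_of_mem hα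
      refine ⟨⟨f, α, hf.1, fun β hβ => ⟨p β, hf.2.2 β hβ⟩⟩, ?_⟩
      exact Subtype.ext ((hP _).p_unique hf)
  have hdisj : ∀ α ∈ (Finset.univ : Finset A), ∀ β ∈ (Finset.univ : Finset A), α ≠ β →
      Disjoint (WF (Finset.univ.erase α) {α}) (WF (Finset.univ.erase β) {β}) := by
    intro α _ β _ hne
    rw [Finset.disjoint_left]
    intro p h1 h2
    obtain ⟨f, hf⟩ := exists_of_mem h1
    obtain ⟨g, hg⟩ := exists_of_mem h2
    exact hne (hf.root hg)
  rw [hb, Finset.card_biUnion hdisj]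
  obtain ⟨m, rfl⟩ : ∃ m, k = m + 1 := ⟨k - 1, by omega⟩
  have h1 : ∀ α : A, (WF (Finset.univ.erase α) {α}).card * (m + 1) = (m + 1) ^ m := by
    intro α
    have := WF_card m (Finset.univ.erase α) {α} (by simp) (by simp [hcard])
    simpa using this
  have h2 : (∑ α : A, (WF (Finset.univ.erase α) {α}).card) * (m + 1)
      = (m + 1) ^ m * (m + 1) := by
    rw [Finset.sum_mul, Finset.sum_congr rfl (fun α _ => h1 α)]
    simp [hcard, mul_comm]
  simpa using Nat.eq_of_mul_eq_mul_right (Nat.succ_pos m) h2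
end

section
/- Given any infinite LSP word w over a finite alphabet A, there exist a unique infinite word w' and a unique R-bLSP morphism f defined exactly on alph(w') such that w = f(w'). -/
theorem infPrefix_succ {A : Type*} (w : ℕ → A) (n : ℕ) :
    infPrefix w (n + 1) = infPrefix w n ++ [w n] := by
  unfold infPrefix
  rw [List.ofFn_succ']
  simp

theorem isPrefixI_infPrefix {A : Type*} (w : ℕ → A) (n : ℕ) : IsPrefixI (infPrefix w n) w := by
  intro i h
  simp [infPrefix]

theorem applyM_succ {A B : Type*} (f : A → List B) (v : ℕ → A) (n : ℕ) :
    applyM f (infPrefix v (n + 1)) = applyM f (infPrefix v n) ++ f (v n) := by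
  simp [infPrefix_succ, applyM]

theorem blsp_shape {A : Type*} (g : A → List A) (α : A) (h0 : g α = [α])
    (h : ∀ β : A, β ≠ α → ∃ γ : A, g β = g γ ++ [β]) :
    ∀ (n : ℕ) (β : A), (g β).length = n →
      (∃ t, g β = α :: t ∧ α ∉ t) ∧ ∃ s, g β = s ++ [β] := by
  intro n
  induction n using Nat.strong_induction_on with
  | _ n ih =>
    intro β hn
    by_cases hβ : β = α
    · subst hβ
      exact ⟨⟨[], by simp [h0]⟩, ⟨[], by simp [h0]⟩⟩
    · obtain ⟨γ, hγ⟩ := h β hβ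
      have hl : (g γ).length < n := by rw [← hn, hγ]; simp
      obtain ⟨⟨t, ht, hat⟩, _⟩ := ih _ hl γ rfl
      refine ⟨⟨t ++ [β], by rw [hγ, ht]; rfl, ?_⟩, ⟨g γ, hγ⟩⟩
      simp only [List.mem_append, List.mem_singleton, not_or]
      exact ⟨hat, fun e => hβ e.symm⟩

/-- Cutting positions of a desubstitution. -/
theorem cuts {A : Type*} (w v : ℕ → A) (f : A → List A)
    (hf : IsRBLSPOn (Set.range v) f) (hi : InfImage f v w) :
    ∃ m : ℕ → ℕ, m 0 = 0 ∧ (∀ n, m n < m (n + 1)) ∧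
      (∀ n, w (m n) = w 0) ∧ (∀ n j, m n < j → j < m (n + 1) → w j ≠ w 0) ∧
      (∀ n, v n = w (m (n + 1) - 1)) ∧
      (∀ n, f (v n) = List.ofFn (fun i : Fin (m (n + 1) - m n) => w (m n + i))) := by
  obtain ⟨_, g, ⟨α, hα, hg⟩, hfg⟩ := hf
  have shape : ∀ n, (∃ t, f (v n) = α :: t ∧ α ∉ t) ∧ ∃ s, f (v n) = s ++ [v n] := by
    intro n
    rw [hfg (v n) ⟨n, rfl⟩]
    exact blsp_shape g α hα hg _ _ rfl
  have hm : ∀ n, (applyM f (infPrefix v (n + 1))).length =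
      (applyM f (infPrefix v n)).length + (f (v n)).length := by
    intro n; rw [applyM_succ, List.length_append]
  have key : ∀ n i (h : i < (f (v n)).length),
      (f (v n))[i] = w ((applyM f (infPrefix v n)).length + i) := by
    intro n i h
    have := hi (n + 1) ((applyM f (infPrefix v n)).length + i) (by rw [hm]; omega)
    rw [← this]
    simp [applyM_succ]
  have m0 : (applyM f (infPrefix v 0)).length = 0 := by simp [applyM, infPrefix]
  have wα : ∀ n, w ((applyM f (infPrefix v n)).length) = α := by
    intro n
    obtain ⟨⟨t, ht, _⟩, _⟩ := shape n
    have := key n 0 (by rw [ht]; simp)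
    simp only [ht, List.getElem_cons_zero] at this
    exact this.symm
  have w0 : w 0 = α := by have := wα 0; rwa [m0] at this
  refine ⟨fun n => (applyM f (infPrefix v n)).length, m0, ?_, ?_, ?_, ?_, ?_⟩
  · intro n
    obtain ⟨⟨t, ht, _⟩, _⟩ := shape n
    simp only [hm, ht, List.length_cons]; omega
  · intro n; simp only [w0, wα]
  · intro n j h1 h2
    simp only [hm] at h1 h2
    obtain ⟨⟨t, ht, hat⟩, _⟩ := shape n
    obtain ⟨i, rfl⟩ : ∃ i, j = (applyM f (infPrefix v n)).length + (i + 1) :=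
      ⟨j - (applyM f (infPrefix v n)).length - 1, by omega⟩
    have hlt : i + 1 < (f (v n)).length := by omega
    rw [w0, ← key n (i + 1) hlt]
    have hit : i < t.length := by rw [ht] at hlt; simpa using hlt
    have : (f (v n))[i + 1] = t[i] := by simp [ht]
    rw [this]
    intro e
    exact hat (e ▸ List.getElem_mem hit)
  · intro n
    obtain ⟨_, ⟨s, hs⟩⟩ := shape n
    have hl : (f (v n)).length = s.length + 1 := by
      have := congrArg List.length hs
      simpa using this
    have hk := key n s.length (by omega)
    simp only [hm, hl]
    rw [show (applyM f (infPrefix v n)).length + (s.length + 1) - 1 =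
      (applyM f (infPrefix v n)).length + s.length by omega, ← hk]
    have : (f (v n))[s.length]? = some (v n) := by rw [hs]; simp
    rw [List.getElem?_eq_getElem (by omega)] at this
    exact (Option.some.inj this).symm
  · intro n
    apply List.ext_getElem
    · simp [hm]
    · intro i h1 h2
      rw [key n i h1]; simp

theorem desub_unique {A : Type*} (w v v' : ℕ → A) (f f' : A → List A)
    (hf : IsRBLSPOn (Set.range v) f) (hi : InfImage f v w)
    (hf' : IsRBLSPOn (Set.range v') f') (hi' : InfImage f' v' w) : v = v' ∧ f = f' := by
  obtain ⟨m, m0, mlt, ma, mn, mv, mf⟩ := cuts w v f hf hi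
  obtain ⟨m', m0', mlt', ma', mn', mv', mf'⟩ := cuts w v' f' hf' hi'
  have hm : ∀ n, m n = m' n := by
    intro n
    induction n with
    | zero => rw [m0, m0']
    | succ n ih =>
      rcases lt_trichotomy (m (n + 1)) (m' (n + 1)) with h | h | h
      · exact absurd (ma (n + 1)) (mn' n _ (by have := mlt n; omega) h)
      · exact h
      · exact absurd (ma' (n + 1)) (mn n _ (by have := mlt' n; omega) h)
  obtain rfl : m = m' := funext hm
  have hv : v = v' := funext fun n => by rw [mv, mv']
  subst hv
  refine ⟨rfl, funext fun x => ?_⟩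
  by_cases hx : x ∈ Set.range v
  · obtain ⟨n, rfl⟩ := hx
    rw [mf, mf']
  · have h1 := (hf.1 x).not.1 hx
    have h2 := (hf'.1 x).not.1 hx
    rw [not_not.1 h1, not_not.1 h2]

open Classical in
/-- The path from the last occurrence of the first letter. -/
noncomputable def pth {A : Type*} (w : ℕ → A) : ℕ → List A
  | 0 => [w 0]
  | k + 1 => if w (k + 1) = w 0 then [w 0] else pth w k ++ [w (k + 1)]

theorem pth_root {A : Type*} (w : ℕ → A) (k : ℕ) (h : w k = w 0) : pth w k = [w 0] := by
  cases k with
  | zero => rfl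
  | succ k => simp [pth, h]

theorem pth_step {A : Type*} (w : ℕ → A) (k : ℕ) (h : w (k + 1) ≠ w 0) :
    pth w (k + 1) = pth w k ++ [w (k + 1)] := by
  simp [pth, h]

theorem lsp_pred {A : Type*} (w : ℕ → A) (hw : IsLSP w) (i j : ℕ)
    (h : w (i + 1) = w (j + 1)) (hne : w (i + 1) ≠ w 0) : w i = w j := by
  by_contra hc
  apply hne
  have := hw [w (i + 1)] ⟨w i, w j, hc, ⟨i, ?_⟩, ⟨j, ?_⟩⟩ 0 (by simp)
  · simpa using this
  · intro k hk
    have : k = 0 ∨ k = 1 := by simp at hk; omega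
    rcases this with rfl | rfl <;> simp
  · intro k hk
    have : k = 0 ∨ k = 1 := by simp at hk; omega
    rcases this with rfl | rfl <;> simp [h]

theorem pth_congr {A : Type*} (w : ℕ → A) (hw : IsLSP w) :
    ∀ i j : ℕ, w i = w j → pth w i = pth w j := by
  intro i
  induction i with
  | zero => intro j h; rw [pth_root w j h.symm]; rfl
  | succ i ih =>
    intro j h
    by_cases hr : w (i + 1) = w 0
    · rw [pth_root w _ hr, pth_root w j (h ▸ hr)]
    · cases j with
      | zero => exact absurd h hr
      | succ j =>
        rw [pth_step w i hr, pth_step w j (h ▸ hr), ih j (lsp_pred w hw i j h hr), h]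

theorem root_often {A : Type*} [Finite A] (w : ℕ → A) (hw : IsLSP w) (N : ℕ) :
    ∃ k, N ≤ k ∧ w (k + 1) = w 0 := by
  by_contra hc
  push Not at hc
  have hne : ∀ k, N + 1 ≤ k → w k ≠ w 0 := by
    intro k hk
    have := hc (k - 1) (by omega)
    rwa [show k - 1 + 1 = k by omega] at this
  have hlen : ∀ i, (pth w (N + i)).length = (pth w N).length + i := by
    intro i
    induction i with
    | zero => rfl
    | succ i ih =>
      rw [← Nat.add_assoc, pth_step w _ (hne _ (by omega)), List.length_append, ih]
      simp; omega
  obtain ⟨i, j, hij, h⟩ := Finite.exists_ne_map_eq_of_infinite (fun i => w (N + i))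
  have h1 := congrArg List.length (pth_congr w hw _ _ h)
  rw [hlen, hlen] at h1
  omega

theorem prefix_pth {A : Type*} (w : ℕ → A) (m : ℕ) (hm : w m = w 0) (d : ℕ)
    (h : ∀ j, m < j → j ≤ m + d → w j ≠ w 0) :
    infPrefix w m ++ pth w (m + d) = infPrefix w (m + d + 1) := by
  induction d with
  | zero => rw [Nat.add_zero, pth_root w m hm, infPrefix_succ, hm]
  | succ d ih =>
    rw [← Nat.add_assoc, pth_step w _ (h _ (by omega) (by omega)), ← List.append_assoc,
      ih (fun j h1 h2 => h j h1 (by omega)), infPrefix_succ w (m + d + 1)]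

theorem desub_exists {A : Type*} [Finite A] (w : ℕ → A) (hw : IsLSP w) :
    ∃ (v : ℕ → A) (f : A → List A), IsRBLSPOn (Set.range v) f ∧ InfImage f v w := by
  classical
  have hnext : ∀ N, ∃ d, w (N + d + 1) = w 0 ∧ ∀ j, N < j → j ≤ N + d → w j ≠ w 0 := by
    intro N
    have hex : ∃ d, w (N + d + 1) = w 0 := by
      obtain ⟨k, hk, h⟩ := root_often w hw N
      exact ⟨k - N, by rwa [show N + (k - N) = k by omega]⟩
    refine ⟨Nat.find hex, Nat.find_spec hex, ?_⟩
    intro j h1 h2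
    have := Nat.find_min hex (m := j - N - 1) (by omega)
    rwa [show N + (j - N - 1) + 1 = j by omega] at this
  choose d hd hd' using hnext
  let m : ℕ → ℕ := fun n => Nat.rec 0 (fun _ r => r + d r + 1) n
  have ms : ∀ n, m (n + 1) = m n + d (m n) + 1 := fun n => rfl
  have mr : ∀ n, w (m n) = w 0 := by
    intro n
    cases n with
    | zero => rfl
    | succ n => rw [ms]; exact hd _
  let v : ℕ → A := fun n => w (m n + d (m n))
  let g : A → List A := fun β => if h : ∃ k, w k = β then pth w h.choose else [w 0, β]
  have hg : ∀ k, g (w k) = pth w k := by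
    intro k
    have h : ∃ k', w k' = w k := ⟨k, rfl⟩
    simp only [g, dif_pos h]
    exact pth_congr w hw _ _ h.choose_spec
  have hb : IsBLSP g := by
    refine ⟨w 0, hg 0, ?_⟩
    intro β hβ
    by_cases h : ∃ k, w k = β
    · obtain ⟨k, rfl⟩ := h
      cases k with
      | zero => exact absurd rfl hβ
      | succ k => exact ⟨w k, by rw [hg, hg, pth_step w k hβ]⟩
    · refine ⟨w 0, ?_⟩
      rw [hg 0]
      simp only [g, dif_neg h]
      rfl
  have hgne : ∀ x, g x ≠ [] := by
    intro x
    obtain ⟨α, h1, h2⟩ := hb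
    obtain ⟨_, s, hs⟩ := blsp_shape g α h1 h2 _ x rfl
    rw [hs]; simp
  refine ⟨v, fun x => if x ∈ Set.range v then g x else [], ⟨?_, g, hb, ?_⟩, ?_⟩
  · intro x
    by_cases hx : x ∈ Set.range v
    · simp only [if_pos hx]; exact ⟨fun _ => hgne x, fun _ => hx⟩
    · simp only [if_neg hx]; exact ⟨fun h => absurd h hx, fun h => absurd rfl h⟩
  · intro x hx
    exact if_pos hx
  · intro n
    have : applyM (fun x => if x ∈ Set.range v then g x else []) (infPrefix v n)
        = infPrefix w (m n) := by
      induction n with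
      | zero => simp [applyM, infPrefix, m]
      | succ n ih =>
        rw [applyM_succ, ih, if_pos ⟨n, rfl⟩, ms]
        simp only [v]
        rw [hg, prefix_pth w (m n) (mr n) _ (hd' _)]
    rw [this]
    exact isPrefixI_infPrefix w _

/-- any infinite LSP word `w` can be desubstituted in a unique way
`w = f(w')` with `f` an R-bLSP morphism defined exactly on `alph(w')`. -/
theorem lsp_unique_desubstitution {A : Type*} [Fintype A] (w : ℕ → A) (hw : IsLSP w) :
    ∃! p : (ℕ → A) × (A → List A),
      IsRBLSPOn (Set.range p.1) p.2 ∧ InfImage p.2 p.1 w := by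
  obtain ⟨v, f, hf, hi⟩ := desub_exists w hw
  refine ⟨(v, f), ⟨hf, hi⟩, ?_⟩
  rintro ⟨v', f'⟩ ⟨hf', hi'⟩
  obtain ⟨h1, h2⟩ := desub_unique w v' v f' f hf' hi' hf hi
  exact Prod.ext h1 h2
end

section
/- Let w be an infinite word and f an R-bLSP morphism defined exactly on alph(w), with α = first(f). Then the fragilities of f(w) are exactly: (i) the fragilities associated with f, namely ε is an (α,b,c,β,γ)-fragility of f(w) whenever b, c are letters distinct from α and from each other, β ≠ γ, and βb and γc are factors of images of letters under f; and (ii) the fragilities of w propagated by f, namely the words u such that for some (a',b',c',β,γ)-fragility v of w and pairwise distinct letters a, b, c, the word u is a common prefix of f(va')α, f(vb')α and f(vc')α extending f(v)α, with ua a prefix of f(va')α, ub a prefix of f(vb')α and uc a prefix of f(vc')α; such a u is an (a,b,c,β,γ)-fragility of f(w). -/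
section FragHelpers
variable {A : Type*}

theorem fh_t1 {u : List A} {w : ℕ → A} (h : IsPrefixI u w) : infPrefix w u.length = u := by
  apply List.ext_getElem
  · simp [infPrefix]
  · intro i h1 h2
    have := h i h2
    simp [infPrefix] at *
    exact this.symm

theorem fh_t2 {u v : List A} {w : ℕ → A} (h : u <+: v) (hv : IsPrefixI v w) : IsPrefixI u w := by
  intro i hi
  have h2 := hv i (lt_of_lt_of_le hi h.length_le)
  rw [← h2]
  simp only [List.get_eq_getElem]
  exact h.getElem hi

theorem fh_t3 (w : ℕ → A) (n : ℕ) : IsPrefixI (infPrefix w n) w := by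
  intro i hi
  simp [infPrefix]

theorem fh_t4 {u : List A} {w : ℕ → A} : IsFactorI u w ↔ ∃ p, IsPrefixI (p ++ u) w := by
  constructor
  · rintro ⟨k, hk⟩
    refine ⟨infPrefix w k, ?_⟩
    intro i hi
    have hl : (infPrefix w k).length = k := by simp [infPrefix]
    simp only [List.get_eq_getElem, List.getElem_append]
    split
    · simp [infPrefix]
    · rename_i hh
      have := hk (i - k) (by simp [hl] at hi hh; omega)
      simp only [List.get_eq_getElem] at this
      simp only [hl] at hh ⊢
      rw [this]; congr 1; omega
  · rintro ⟨p, hp⟩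
    refine ⟨p.length, fun i hi => ?_⟩
    have := hp (p.length + i) (by simp; omega)
    simpa using this

theorem fh_t5 {u v : List A} {w : ℕ → A} (hu : IsPrefixI u w) (hv : IsPrefixI v w)
    (h : u.length ≤ v.length) : u <+: v := by
  rw [List.prefix_iff_eq_take]
  apply List.ext_getElem
  · simp [h]
  · intro i h1 h2
    have a1 := hu i h1
    have a2 := hv i (by omega)
    simp at *
    rw [a1, a2]

theorem fh_succ (w : ℕ → A) (n : ℕ) : infPrefix w (n+1) = infPrefix w n ++ [w n] := by
  unfold infPrefix
  rw [List.ofFn_succ_last]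
  simp

theorem fh_app (f : A → List A) (u v : List A) : applyM f (u ++ v) = applyM f u ++ applyM f v := by
  simp [applyM]

theorem fh_cons (f : A → List A) (d : A) (v : List A) : applyM f (d :: v) = f d ++ applyM f v := by
  simp [applyM]

theorem fh_nil (f : A → List A) : applyM f [] = [] := by
  simp [applyM]

def FHGood (f : A → List A) (α : A) (d : A) : Prop :=
  ∃ t s, f d = α :: t ∧ α ∉ t ∧ f d = s ++ [d]

theorem fh_good_of_blsp {g : A → List A} {α : A} (h1 : g α = [α])
    (h2 : ∀ β : A, β ≠ α → ∃ γ : A, g β = g γ ++ [β]) : ∀ (n : ℕ) (β : A), (g β).length = n →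
    FHGood g α β := by
  intro n
  induction n using Nat.strong_induction_on with
  | _ n ih =>
    intro β hβ
    by_cases hb : β = α
    · subst hb
      exact ⟨[], [], by simp [h1], by simp, by simp [h1]⟩
    · obtain ⟨γ, hγ⟩ := h2 β hb
      obtain ⟨t, s, e1, e2, e3⟩ := ih (g γ).length (by rw [← hβ, hγ]; simp) γ rfl
      refine ⟨t ++ [β], g γ, by rw [hγ, e1]; simp, ?_, hγ⟩
      simp [e2, Ne.symm hb]

theorem fh_split {α : A} {t1 t2 r1 r2 : List A} (h1 : α ∉ t1) (h2 : α ∉ t2)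
    (h : t1 ++ α :: r1 = t2 ++ α :: r2) : t1 = t2 := by
  induction t1 generalizing t2 with
  | nil => cases t2 <;> simp_all
  | cons a t ih =>
    cases t2 with
    | nil => simp_all
    | cons b t' =>
      simp only [List.cons_append, List.cons.injEq, List.mem_cons, not_or] at *
      exact ⟨h.1, ih h1.2 h2.2 h.2⟩

variable {f : A → List A} {α : A}

theorem fh_head {W : List A} (hW : ∀ d ∈ W, FHGood f α d) (h : applyM f W ≠ []) :
    ∃ r, applyM f W = α :: r := by
  cases W with
  | nil => simp [fh_nil] at h
  | cons d W =>
    obtain ⟨t, s, e1, -, -⟩ := hW d (by simp)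
    exact ⟨t ++ applyM f W, by rw [fh_cons, e1]; simp⟩

/-- cut -/
theorem fh_A {W : List A} (hW : ∀ d ∈ W, FHGood f α d) {p r : List A} {β : A}
    (h : p ++ β :: α :: r = applyM f W) :
    ∃ W1 W2, W = W1 ++ β :: W2 ∧ applyM f W2 = α :: r := by
  induction W generalizing p with
  | nil => simp [fh_nil] at h
  | cons d W ih =>
    obtain ⟨t, s, e1, e2, e3⟩ := hW d (by simp)
    have ih := @ih (fun d hd => hW d (by simp [hd]))
    rw [fh_cons] at h
    have h' : (p ++ [β]) ++ α :: r = f d ++ applyM f W := by simpa using h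
    rcases List.append_eq_append_iff.1 h' with ⟨q, q1, q2⟩ | ⟨q, q1, q2⟩
    · cases q with
      | nil =>
        have : s ++ [d] = p ++ [β] := by rw [← e3, q1]; simp
        have hd : d = β := by
          have := congrArg List.getLast? this
          simpa using this
        exact ⟨[], W, by simp [hd], by simpa using q2.symm⟩
      | cons y q =>
        exfalso
        simp only [List.cons_append, List.cons.injEq] at q2
        obtain ⟨rfl, -⟩ := q2
        rw [e1] at q1
        cases p with
        | nil => simp at q1; apply e2; rw [q1.2]; simp
        | cons => simp at q1; apply e2; rw [q1.2]; simp
    · rcases List.eq_nil_or_concat q with rfl | ⟨q', y, rfl⟩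
      · have : s ++ [d] = p ++ [β] := by rw [← e3, q1]; simp
        have hd : d = β := by
          have := congrArg List.getLast? this
          simpa using this
        exact ⟨[], W, by simp [hd], by simpa using q2⟩
      · have hy : β = y := by
          have := congrArg List.getLast? q1
          simpa using this
        subst hy
        obtain ⟨W1, W2, rfl, h2⟩ := @ih q' (by rw [q2]; simp)
        exact ⟨d :: W1, W2, by simp, h2⟩

theorem fh_B {v W : List A} (hv : ∀ d ∈ v, FHGood f α d) (hW : ∀ d ∈ W, FHGood f α d)
    (h : applyM f v ++ [α] <+: applyM f W) : ∃ W2, W = v ++ W2 := by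
  induction v generalizing W with
  | nil => exact ⟨W, rfl⟩
  | cons d v ih =>
    have hv' : ∀ d ∈ v, FHGood f α d := fun d hd => hv d (by simp [hd])
    cases W with
    | nil => simp [fh_nil] at h
    | cons e W =>
      have hW' : ∀ d ∈ W, FHGood f α d := fun d hd => hW d (by simp [hd])
      obtain ⟨t, s, e1, e2, e3⟩ := hv d (by simp)
      obtain ⟨t', s', e1', e2', e3'⟩ := hW e (by simp)
      obtain ⟨r, hr⟩ : ∃ r, applyM f v ++ [α] = α :: r := by
        by_cases hn : applyM f v = []
        · exact ⟨[], by simp [hn]⟩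
        · obtain ⟨r, hr⟩ := fh_head hv' hn
          exact ⟨r ++ [α], by simp [hr]⟩
      have hde : f d = f e := by
        rw [fh_cons, fh_cons, List.append_assoc, hr, e1, e1'] at h
        obtain ⟨q, hq⟩ := h
        simp only [List.cons_append, List.append_assoc, List.cons.injEq, true_and] at hq
        by_cases hn : applyM f W = []
        · exfalso
          rw [hn] at hq
          apply e2'
          rw [List.append_nil] at hq
          rw [← hq]; simp
        · obtain ⟨r', hr'⟩ := fh_head hW' hn
          rw [hr'] at hq
          rw [e1, e1', fh_split e2 e2' hq]
      have : d = e := by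
        rw [e3, e3'] at hde
        have := congrArg List.getLast? hde
        simpa using this
      subst this
      rw [fh_cons, fh_cons, List.append_assoc, List.prefix_append_right_inj] at h
      obtain ⟨W2, rfl⟩ := ih hv' hW' h
      exact ⟨W2, by simp⟩

theorem fh_C {W u : List A} (hW : ∀ d ∈ W, FHGood f α d) (hu : u ≠ [])
    (h : u <+: applyM f W) :
    ∃ v z, u = applyM f v ++ α :: z ∧ α ∉ z ∧ ∀ d ∈ v, FHGood f α d := by
  induction W generalizing u with
  | nil => simp [fh_nil] at h; exact absurd h hu
  | cons d W ih =>
    obtain ⟨t, s, e1, e2, e3⟩ := hW d (by simp)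
    have hW' : ∀ d ∈ W, FHGood f α d := fun d hd => hW d (by simp [hd])
    rw [fh_cons] at h
    obtain ⟨q, hq⟩ := h
    have base : ∀ q, f d = u ++ q →
        ∃ v z, u = applyM f v ++ α :: z ∧ α ∉ z ∧ ∀ d ∈ v, FHGood f α d := by
      intro q hq
      cases u with
      | nil => exact absurd rfl hu
      | cons y u =>
        rw [e1] at hq
        simp only [List.cons_append, List.cons.injEq] at hq
        refine ⟨[], u, by simp [fh_nil, hq.1], ?_, by simp⟩
        intro hm; apply e2; rw [hq.2]; simp [hm]
    rcases List.append_eq_append_iff.1 hq with ⟨q', q1, q2⟩ | ⟨q', q1, q2⟩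
    · exact base q' q1
    · by_cases hn : q' = []
      · subst hn
        exact base [] (by simpa using q1.symm)
      · obtain ⟨v, z, k1, k2, k3⟩ := ih hW' hn ⟨q, q2.symm⟩
        refine ⟨d :: v, z, by rw [q1, k1, fh_cons]; simp, k2, ?_⟩
        intro e he
        rcases List.mem_cons.1 he with rfl | he
        · exact ⟨t, s, e1, e2, e3⟩
        · exact k3 e he

theorem fh_E {W z : List A} {b : A} (hW : ∀ d ∈ W, FHGood f α d) (hz : α ∉ z)
    (h : α :: z ++ [b] <+: applyM f W) :
    ∃ d W', W = d :: W' ∧ α :: z ++ [b] <+: f d ++ [α] := by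
  cases W with
  | nil => simp [fh_nil] at h
  | cons d W =>
    refine ⟨d, W, rfl, ?_⟩
    obtain ⟨t, s, e1, e2, e3⟩ := hW d (by simp)
    have hW' : ∀ d ∈ W, FHGood f α d := fun d hd => hW d (by simp [hd])
    rw [fh_cons] at h
    by_cases hn : applyM f W = []
    · rw [hn, List.append_nil] at h
      exact h.trans (List.prefix_append _ _)
    · obtain ⟨r, hr⟩ := fh_head hW' hn
      rw [hr, e1] at h
      obtain ⟨q, hq⟩ := h
      simp only [List.cons_append, List.cons.injEq, true_and] at hq
      rw [e1]
      simp only [List.cons_append, List.prefix_cons_inj]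
      rcases List.append_eq_append_iff.1 hq with ⟨q', q1, q2⟩ | ⟨q', q1, q2⟩
      · rw [q1]; exact ⟨q' ++ [α], by simp⟩
      · rcases List.eq_nil_or_concat q' with rfl | ⟨q'', y, rfl⟩
        · rw [q1]; simp
        · cases q'' with
          | nil =>
            simp at q2
            rw [q1, q2.1]; simp
          | cons y' q'' =>
            exfalso
            simp at q2
            rw [List.concat_eq_append, ← List.append_assoc] at q1
            have := (List.append_inj' q1 rfl).1
            apply hz; rw [this, q2.1]; simp

theorem fh_G {W : List A} (hW : ∀ d ∈ W, FHGood f α d) {p r : List A} {β b : A} (hb : b ≠ α)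
    (h : p ++ β :: b :: r = applyM f W) : ∃ d ∈ W, [β, b] <:+: f d := by
  induction W generalizing p with
  | nil => simp [fh_nil] at h
  | cons d W ih =>
    have hW' : ∀ d ∈ W, FHGood f α d := fun d hd => hW d (by simp [hd])
    rw [fh_cons] at h
    have hrec : ∀ p, p ++ β :: b :: r = applyM f W → ∃ e ∈ d :: W, [β, b] <:+: f e := by
      intro p hp
      obtain ⟨e, he, h⟩ := ih hW' hp
      exact ⟨e, by simp [he], h⟩
    rcases List.append_eq_append_iff.1 h with ⟨q, q1, q2⟩ | ⟨q, q1, q2⟩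
    · cases q with
      | nil => exact hrec [] (by simpa using q2)
      | cons y q =>
        cases q with
        | nil =>
          exfalso
          simp at q2
          obtain ⟨r', hr'⟩ := fh_head hW' (by rw [← q2.2]; simp)
          rw [hr'] at q2
          simp at q2
          exact hb q2.2.1
        | cons y' q =>
          simp at q2
          refine ⟨d, by simp, p, q, ?_⟩
          rw [q1, q2.1, q2.2.1]; simp
    · exact hrec q q2.symm

theorem fh_core {v z W : List A} {b : A} (hv : ∀ d ∈ v, FHGood f α d)
    (hW : ∀ d ∈ W, FHGood f α d) (hz : α ∉ z)
    (h : (applyM f v ++ α :: z) ++ [b] <+: applyM f W) :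
    ∃ b', (v ++ [b']) <+: W ∧
      (applyM f v ++ α :: z) ++ [b] <+: applyM f (v ++ [b']) ++ [α] := by
  obtain ⟨W2, rfl⟩ := fh_B hv hW (List.IsPrefix.trans ⟨z ++ [b], by simp⟩ h)
  rw [fh_app, List.append_assoc, List.prefix_append_right_inj] at h
  obtain ⟨d, W', rfl, h'⟩ := fh_E (fun d hd => hW d (by simp [hd])) hz h
  refine ⟨d, ⟨W', by simp⟩, ?_⟩
  rw [fh_app, List.append_assoc, List.append_assoc, List.prefix_append_right_inj]
  simpa [fh_cons, fh_nil] using h'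

theorem fh_ne {p q r : List A} {a b : A} (hab : a ≠ b)
    (h1 : p ++ [a] <+: r ++ q) (h2 : p ++ [b] <+: r ++ q) : False := by
  have := List.prefix_of_prefix_length_le h1 h2 (by simp)
  rw [List.prefix_append_right_inj] at this
  simp at this
  exact hab this

end FragHelpers

/-- the fragilities of `f(w)` are exactly the fragilities associated
with `f` and the fragilities of `w` propagated by `f`. -/
theorem fragilities_of_image {A : Type*} (w x : ℕ → A) (f : A → List A)
    (hf : IsRBLSPOn (Set.range w) f) (α : A)
    (hα : ∀ d ∈ Set.range w, (f d).head? = some α)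
    (hx : InfImage f w x) :
    ∀ (u : List A) (a b c β γ : A), a ≠ b → b ≠ c → a ≠ c → β ≠ γ →
      (Frag5 x a b c β γ u ↔
        ((u = [] ∧ a = α ∧ (∃ d ∈ Set.range w, [β, b] <:+: f d) ∧
            (∃ e ∈ Set.range w, [γ, c] <:+: f e)) ∨
          (∃ (v : List A) (a' b' c' : A), a' ≠ b' ∧ b' ≠ c' ∧ a' ≠ c' ∧
            Frag5 w a' b' c' β γ v ∧
            (applyM f v ++ [α]) <+: u ∧
            (u ++ [a]) <+: (applyM f (v ++ [a']) ++ [α]) ∧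
            (u ++ [b]) <+: (applyM f (v ++ [b']) ++ [α]) ∧
            (u ++ [c]) <+: (applyM f (v ++ [c']) ++ [α])))) := by
  obtain ⟨hD, g, ⟨α0, hg1, hg2⟩, hfg⟩ := hf
  have hgood0 : ∀ d ∈ Set.range w, FHGood f α0 d := by
    intro d hd
    have := fh_good_of_blsp hg1 hg2 _ d rfl
    unfold FHGood
    rw [hfg d hd]
    exact this
  have hαα : α0 = α := by
    have h := hα (w 0) ⟨0, rfl⟩
    obtain ⟨t, s, e1, -, -⟩ := hgood0 (w 0) ⟨0, rfl⟩
    rw [e1] at h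
    simpa using h
  subst hαα
  have hgood : ∀ n, ∀ d ∈ infPrefix w n, FHGood f α0 d := by
    intro n d hd
    apply hgood0
    simp [infPrefix, List.mem_ofFn] at hd
    obtain ⟨i, rfl⟩ := hd
    exact ⟨_, rfl⟩
  have hlen : ∀ n, n ≤ (applyM f (infPrefix w n)).length := by
    intro n
    induction n with
    | zero => simp
    | succ n ih =>
      obtain ⟨t, s, e1, -, -⟩ := hgood0 (w n) ⟨n, rfl⟩
      rw [fh_succ, fh_app, fh_cons, e1]
      simp; omega
  have hpre : ∀ u, IsPrefixI u x → u <+: applyM f (infPrefix w u.length) :=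
    fun u hu => fh_t5 hu (hx _) (hlen _)
  have hext : ∀ v, IsPrefixI v w → IsPrefixI (applyM f v ++ [α0]) x := by
    intro v hv
    refine fh_t2 ?_ (hx (v.length + 1))
    obtain ⟨t, s, e1, -, -⟩ := hgood0 (w v.length) ⟨_, rfl⟩
    rw [fh_succ, fh_app, fh_t1 hv, List.prefix_append_right_inj, fh_cons, e1]
    simp
  have hfac : ∀ (v u : List A) (β b : A), IsFactorI (β :: v) w → u ++ [b] <+: applyM f v ++ [α0] →
      IsFactorI (β :: (u ++ [b])) x := by
    intro v u β b h hu
    obtain ⟨p, hp⟩ := fh_t4.1 h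
    have hβ : β ∈ Set.range w := by
      have := hp p.length (by simp)
      simp at this
      exact ⟨_, this.symm⟩
    obtain ⟨t, s, -, -, e3⟩ := hgood0 β hβ
    have h2 := hext _ hp
    rw [fh_app, fh_cons, e3] at h2
    rw [fh_t4]
    refine ⟨applyM f p ++ s, fh_t2 ?_ h2⟩
    obtain ⟨q, hq⟩ := hu
    refine ⟨q, ?_⟩
    simp only [List.append_assoc, List.cons_append, List.nil_append] at hq ⊢
    rw [hq]
  intro u a b c β γ hab hbc hac hβγ
  constructor
  · rintro ⟨h1, h2, h3⟩
    obtain ⟨p2, h2⟩ := fh_t4.1 h2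
    obtain ⟨p3, h3⟩ := fh_t4.1 h3
    have h1 := hpre _ h1
    have h2 := hpre _ h2
    have h3 := hpre _ h3
    by_cases hu : u = []
    · left
      subst hu
      have ha : a = α0 := by
        obtain ⟨r, hr⟩ := fh_head (hgood _) (by intro h; rw [h] at h1; simp at h1)
        rw [hr] at h1
        simpa using h1
      subst ha
      refine ⟨rfl, rfl, ?_, ?_⟩
      · obtain ⟨q, hq⟩ := h2
        obtain ⟨d, hd, h⟩ := fh_G (p := p2) (r := q) (β := β) (b := b) (hgood _) hab.symm (by rw [← hq]; simp)
        simp only [infPrefix, List.mem_ofFn] at hd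
        obtain ⟨i, rfl⟩ := hd
        exact ⟨_, ⟨_, rfl⟩, h⟩
      · obtain ⟨q, hq⟩ := h3
        obtain ⟨d, hd, h⟩ := fh_G (p := p3) (r := q) (β := γ) (b := c) (hgood _) hac.symm (by rw [← hq]; simp)
        simp only [infPrefix, List.mem_ofFn] at hd
        obtain ⟨i, rfl⟩ := hd
        exact ⟨_, ⟨_, rfl⟩, h⟩
    · right
      obtain ⟨v, z, rfl, hz, hv⟩ := fh_C (hgood _) hu
        ((List.prefix_append u [a]).trans h1)
      obtain ⟨a', ha1, ha2⟩ := fh_core hv (hgood _) hz h1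
      have key : ∀ (p : List A) (n : ℕ) (β b : A),
          p ++ β :: ((applyM f v ++ α0 :: z) ++ [b]) <+: applyM f (infPrefix w n) →
          ∃ b', IsFactorI (β :: (v ++ [b'])) w ∧
            (applyM f v ++ α0 :: z) ++ [b] <+: applyM f (v ++ [b']) ++ [α0] := by
        intro p n β b h
        obtain ⟨r, hr⟩ : ∃ r, (applyM f v ++ α0 :: z) ++ [b] = α0 :: r := by
          by_cases hn : applyM f v = []
          · exact ⟨z ++ [b], by simp [hn]⟩
          · obtain ⟨r, hr⟩ := fh_head hv hn
            exact ⟨r ++ α0 :: z ++ [b], by simp [hr]⟩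
        obtain ⟨q, hq⟩ := h
        obtain ⟨W1, W2, hW, hW2⟩ := fh_A (p := p) (β := β) (r := r ++ q) (hgood n)
          (by rw [← hq, hr]; simp)
        obtain ⟨b', hb1, hb2⟩ := fh_core (b := b) (W := W2) hv
          (fun d hd => hgood n d (by rw [hW]; simp [hd])) hz
          (by rw [hW2, hr]; exact ⟨q, by simp⟩)
        refine ⟨b', fh_t4.2 ⟨W1, fh_t2 ?_ (fh_t3 w n)⟩, hb2⟩
        rw [hW, List.prefix_append_right_inj, List.prefix_cons_inj]
        exact hb1
      obtain ⟨b', hb1, hb2⟩ := key _ _ _ _ h2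
      obtain ⟨c', hc1, hc2⟩ := key _ _ _ _ h3
      refine ⟨v, a', b', c', ?_, ?_, ?_, ⟨fh_t2 ha1 (fh_t3 _ _), hb1, hc1⟩, ⟨z, by simp⟩,
        ha2, hb2, hc2⟩
      · rintro rfl; exact fh_ne hab ha2 hb2
      · rintro rfl; exact fh_ne hbc hb2 hc2
      · rintro rfl; exact fh_ne hac ha2 hc2
  · rintro (⟨rfl, rfl, ⟨d, ⟨k, rfl⟩, hd⟩, ⟨e, ⟨l, rfl⟩, he⟩⟩ |
      ⟨v, a', b', c', -, -, -, ⟨h1, h2, h3⟩, -, ha, hb, hc⟩)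
    · have key : ∀ (l : List A) (k : ℕ), l <:+: f (w k) → IsFactorI l x := by
        rintro l k ⟨s, t, h⟩
        rw [fh_t4]
        refine ⟨applyM f (infPrefix w k) ++ s, fh_t2 ?_ (hx (k+1))⟩
        rw [fh_succ, fh_app, fh_cons, ← h]
        exact ⟨t, by simp [fh_nil]⟩
      refine ⟨?_, key _ _ hd, key _ _ he⟩
      have := hext [] (fun i hi => by simp at hi)
      simpa [fh_nil] using this
    · exact ⟨fh_t2 ha (hext _ h1), hfac _ _ _ _ h2 hb, hfac _ _ _ _ h3 hc⟩
end
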